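/- Let G be a group, Σ a finite set with d = #Σ ≥ 2 elements, and ψ : G → G ≀_Σ Sym(Σ) an injective group homomorphism into the permutational wreath product, with sections g_x and action σ_g given by ψ(g) = ((g_x)_{x∈Σ}, σ_g). Let S be a finite semigroup-generating set of G with positive weight π, and suppose there exist an essentially geodesic generating set (egg) Δ for (G,S,π) and η ∈ (0,1) such that for every word δ ∈ Δ with represented element δ̄, Σ_{x∈Σ} ‖(δ̄)_x‖_{S,π} ≤ η·‖δ̄‖_{S,π}. Then there is a constant c > 0 such that γ_{G,S,π}(ℓ) ≤ exp(c·ℓ^α) for all ℓ ≥ 0, where α = log(d) / (log(d) − log(η)); in particular G has subexponential growth. -/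

import Mathlib

/-- The `π`-length of a word `w` over the group `G`: the sum of the weights of its letters. -/
noncomputable def wlen {G : Type*} (π : G → ℝ) (w : List G) : ℝ := (w.map π).sum

/-- The weighted word norm of `g` with respect to the generating set `S` and weight `π`:
the infimum of the `π`-lengths of words over `S` evaluating to `g`. -/
noncomputable def wnorm {G : Type*} [Group G] (S : Set G) (π : G → ℝ) (g : G) : ℝ :=
  sInf {r : ℝ | ∃ w : List G, (∀ x ∈ w, x ∈ S) ∧ w.prod = g ∧ wlen π w = r}

/-- The growth function `γ_{G,S,π}(ℓ)`: the cardinality of the ball of radius `ℓ`. -/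
noncomputable def growth {G : Type*} [Group G] (S : Set G) (π : G → ℝ) (ℓ : ℝ) : ℕ :=
  Nat.card {g : G | wnorm S π g ≤ ℓ}

/-- A finite set `Δ` of words over `S` is an essentially geodesic generating set (egg)
for `(G,S,π)`. -/
def IsEgg {G : Type*} [Group G] (S : Set G) (π : G → ℝ) (Δ : Set (List G)) : Prop :=
  Δ.Finite ∧ (∀ w ∈ Δ, ∀ x ∈ w, x ∈ S) ∧
  ∃ F : Set (List G), F.Finite ∧ (∀ w ∈ F, ∀ x ∈ w, x ∈ S) ∧
    ∀ g : G, ∃ (ds : List (List G)) (h : List G),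
      (∀ d ∈ ds, d ∈ Δ) ∧ h ∈ F ∧
      (ds.flatten ++ h).prod = g ∧ wlen π (ds.flatten ++ h) = wnorm S π g

/-- The data `(sec, act)` encodes an injective homomorphism
`ψ : G → G ≀_Σ Sym(Σ)`, `ψ(g) = ((sec g x)_{x ∈ Σ}, act g)`, into the permutational
wreath product: `act` is a homomorphism, the section maps satisfy the wreath product
multiplication law `sec (g·h) x = sec g x · sec h ((act g)⁻¹ x)`, and `g ↦ (sec g, act g)`
is injective. -/
structure WreathEmbedding (G : Type*) [Group G] (Alp : Type*) where
  sec : G → Alp → G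
  act : G →* Equiv.Perm Alp
  sec_one : ∀ x : Alp, sec 1 x = 1
  sec_mul : ∀ (g h : G) (x : Alp), sec (g * h) x = sec g x * sec h ((act g)⁻¹ x)
  inj : Function.Injective fun g => (sec g, act g)

section WordNorm

variable {G : Type*} {S : Set G} {π : G → ℝ}

lemma wlen_append (v w : List G) : wlen π (v ++ w) = wlen π v + wlen π w := by
  simp [wlen]

lemma wlen_flatten (ds : List (List G)) : wlen π ds.flatten = (ds.map (wlen π)).sum := by
  induction ds with
  | nil => simp [wlen]
  | cons d ds ih => simp [wlen_append, ih]

lemma length_mul_le_wlen {m : ℝ} (hm : ∀ s ∈ S, m ≤ π s) (w : List G) (hw : ∀ x ∈ w, x ∈ S) :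
    w.length * m ≤ wlen π w := by
  induction w with
  | nil => simp [wlen]
  | cons a w ih =>
    have h1 := ih fun x hx => hw x (by simp [hx])
    have h2 := hm a (hw a (by simp))
    simp only [wlen, List.map_cons, List.sum_cons, List.length_cons] at h1 ⊢
    push_cast
    linarith

lemma wlen_nonneg (hπ : ∀ s ∈ S, 0 < π s) (w : List G) (hw : ∀ x ∈ w, x ∈ S) :
    0 ≤ wlen π w := by
  simpa using length_mul_le_wlen (fun s hs => (hπ s hs).le) w hw

lemma exists_pos_le_weight (hSfin : S.Finite) (hπ : ∀ s ∈ S, 0 < π s) :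
    ∃ m : ℝ, 0 < m ∧ ∀ s ∈ S, m ≤ π s := by
  rcases S.eq_empty_or_nonempty with rfl | hne
  · exact ⟨1, one_pos, by simp⟩
  · obtain ⟨s, hs, hmin⟩ := hSfin.exists_minimalFor π S hne
    refine ⟨π s, hπ s hs, fun t ht => ?_⟩
    by_contra! hlt
    exact absurd (hmin ht hlt.le) (not_le.2 hlt)

variable [Group G]

lemma wnorm_nonneg (hπ : ∀ s ∈ S, 0 < π s) (g : G) : 0 ≤ wnorm S π g := by
  apply Real.sInf_nonneg
  rintro _ ⟨w, hw, -, rfl⟩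
  exact wlen_nonneg hπ w hw

lemma wnorm_prod_le_wlen (hπ : ∀ s ∈ S, 0 < π s) (w : List G) (hw : ∀ x ∈ w, x ∈ S) :
    wnorm S π w.prod ≤ wlen π w := by
  refine csInf_le ⟨0, ?_⟩ ⟨w, hw, rfl, rfl⟩
  rintro _ ⟨v, hv, -, rfl⟩
  exact wlen_nonneg hπ v hv

lemma exists_word_wlen_lt (hgen : ∀ g : G, ∃ w : List G, (∀ x ∈ w, x ∈ S) ∧ w.prod = g)
    {g : G} {r : ℝ} (h : wnorm S π g < r) :
    ∃ w : List G, (∀ x ∈ w, x ∈ S) ∧ w.prod = g ∧ wlen π w < r := by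
  obtain ⟨w₀, hw₀, hg₀⟩ := hgen g
  obtain ⟨_, ⟨w, hw, hg, rfl⟩, hlt⟩ := exists_lt_of_csInf_lt (by exact ⟨_, w₀, hw₀, hg₀, rfl⟩) h
  exact ⟨w, hw, hg, hlt⟩

lemma wnorm_one (hπ : ∀ s ∈ S, 0 < π s) : wnorm S π 1 = 0 :=
  le_antisymm (by simpa [wlen] using wnorm_prod_le_wlen hπ [] (by simp)) (wnorm_nonneg hπ 1)

lemma wnorm_mul_le (hπ : ∀ s ∈ S, 0 < π s)
    (hgen : ∀ g : G, ∃ w : List G, (∀ x ∈ w, x ∈ S) ∧ w.prod = g) (g h : G) :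
    wnorm S π (g * h) ≤ wnorm S π g + wnorm S π h := by
  refine le_of_forall_pos_le_add fun ε hε => ?_
  obtain ⟨v, hv, rfl, hlv⟩ :=
    exists_word_wlen_lt hgen (lt_add_of_pos_right (wnorm S π g) (half_pos hε))
  obtain ⟨w, hw, rfl, hlw⟩ :=
    exists_word_wlen_lt hgen (lt_add_of_pos_right (wnorm S π h) (half_pos hε))
  have := wnorm_prod_le_wlen hπ (v ++ w) (by
    intro x hx
    rcases List.mem_append.1 hx with hx | hx
    exacts [hv x hx, hw x hx])
  rw [wlen_append, List.prod_append] at this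
  linarith

lemma eq_one_of_wnorm_lt (hgen : ∀ g : G, ∃ w : List G, (∀ x ∈ w, x ∈ S) ∧ w.prod = g)
    {m : ℝ} (hm : ∀ s ∈ S, m ≤ π s) (hπ : ∀ s ∈ S, 0 < π s) {g : G} (hg : wnorm S π g < m) :
    g = 1 := by
  obtain ⟨w, hw, rfl, hlt⟩ := exists_word_wlen_lt hgen hg
  cases w with
  | nil => rfl
  | cons a w =>
    have h1 := hm a (hw a (by simp))
    have h2 := wlen_nonneg hπ w fun x hx => hw x (by simp [hx])
    simp only [wlen, List.map_cons, List.sum_cons] at h2 hlt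
    linarith

lemma finite_ball (hSfin : S.Finite) (hπ : ∀ s ∈ S, 0 < π s)
    (hgen : ∀ g : G, ∃ w : List G, (∀ x ∈ w, x ∈ S) ∧ w.prod = g) (ℓ : ℝ) :
    {g : G | wnorm S π g ≤ ℓ}.Finite := by
  obtain ⟨m, hm0, hm⟩ := exists_pos_le_weight hSfin hπ
  have : Finite S := hSfin
  refine ((List.finite_length_le S ⌊(ℓ + 1) / m⌋₊).image
    fun w : List S => (w.map Subtype.val).prod).subset fun g hg => ?_
  obtain ⟨w, hw, rfl, hlt⟩ := exists_word_wlen_lt hgen (lt_of_le_of_lt hg (lt_add_one ℓ))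
  lift w to List S using hw
  refine ⟨w, Nat.le_floor ?_, rfl⟩
  have := length_mul_le_wlen hm (w.map Subtype.val) (by simp +contextual)
  rw [List.length_map] at this
  rw [le_div_iff₀ hm0]
  linarith

end WordNorm

section Contraction

variable {G : Type*} [Group G] {S : Set G} {π : G → ℝ} {Alp : Type*} [Fintype Alp]

lemma WreathEmbedding.sum_wnorm_sec_mul_le (ψ : WreathEmbedding G Alp) (hπ : ∀ s ∈ S, 0 < π s)
    (hgen : ∀ g : G, ∃ w : List G, (∀ x ∈ w, x ∈ S) ∧ w.prod = g) (g h : G) :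
    ∑ x, wnorm S π (ψ.sec (g * h) x) ≤
      ∑ x, wnorm S π (ψ.sec g x) + ∑ x, wnorm S π (ψ.sec h x) := by
  rw [← Equiv.sum_comp (ψ.act g)⁻¹ fun x => wnorm S π (ψ.sec h x), ← Finset.sum_add_distrib]
  refine Finset.sum_le_sum fun x _ => ?_
  rw [ψ.sec_mul]
  exact wnorm_mul_le hπ hgen _ _

/-- Strong contraction on an egg gives strong contraction on `G`, up to an additive constant. -/
lemma exists_sum_wnorm_sec_le (ψ : WreathEmbedding G Alp) (hπ : ∀ s ∈ S, 0 < π s)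
    (hgen : ∀ g : G, ∃ w : List G, (∀ x ∈ w, x ∈ S) ∧ w.prod = g)
    {Δ : Set (List G)} (hΔ : IsEgg S π Δ) {η : ℝ} (hη : 0 ≤ η)
    (hcontr : ∀ δ ∈ Δ, ∑ x : Alp, wnorm S π (ψ.sec δ.prod x) ≤ η * wnorm S π δ.prod) :
    ∃ C : ℝ, 0 ≤ C ∧ ∀ g : G, ∑ x, wnorm S π (ψ.sec g x) ≤ η * wnorm S π g + C := by
  obtain ⟨-, hΔS, F, hF, hFS, hrep⟩ := hΔ
  obtain ⟨C, hC⟩ := (hF.image fun h => ∑ x, wnorm S π (ψ.sec h.prod x)).bddAbove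
  have hflat : ∀ ds : List (List G), (∀ d ∈ ds, d ∈ Δ) →
      ∑ x, wnorm S π (ψ.sec ds.flatten.prod x) ≤ η * wlen π ds.flatten := by
    intro ds
    induction ds with
    | nil => simp [ψ.sec_one, wnorm_one hπ, wlen]
    | cons d ds ih =>
      intro hds
      have h1 := ih fun e he => hds e (by simp [he])
      have hd := hds d (by simp)
      have h2 := mul_le_mul_of_nonneg_left (wnorm_prod_le_wlen hπ d (hΔS d hd)) hη
      rw [List.flatten_cons, List.prod_append, wlen_append]
      linarith [ψ.sum_wnorm_sec_mul_le hπ hgen d.prod ds.flatten.prod, hcontr d hd]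
  refine ⟨max C 0, le_max_right _ _, fun g => ?_⟩
  obtain ⟨ds, h, hds, hh, rfl, hlen⟩ := hrep g
  rw [← hlen, List.prod_append, wlen_append]
  have h1 : ∑ x, wnorm S π (ψ.sec h.prod x) ≤ C := hC ⟨h, hh, rfl⟩
  have h2 := mul_nonneg hη (wlen_nonneg hπ h (hFS h hh))
  linarith [ψ.sum_wnorm_sec_mul_le hπ hgen ds.flatten.prod h.prod, hflat ds hds, le_max_left C 0]

/-- `PortraitCode ψ B g w` says that `w` is the preorder traversal of a finite portrait of `g`,
with leaves labelled by elements of `B` and inner vertices labelled by permutations. -/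
inductive PortraitCode (ψ : WreathEmbedding G Alp) (B : Set G) :
    G → List (B ⊕ Equiv.Perm Alp) → Prop
  | leaf (b : B) : PortraitCode ψ B b [Sum.inl b]
  | node (g : G) (ws : Alp → List (B ⊕ Equiv.Perm Alp))
      (h : ∀ x, PortraitCode ψ B (ψ.sec g x) (ws x)) :
      PortraitCode ψ B g (Sum.inr (ψ.act g) :: Finset.univ.toList.flatMap ws)

lemma PortraitCode.eq_of_append_eq {ψ : WreathEmbedding G Alp} {B : Set G} {g g' : G}
    {w w' u u' : List (B ⊕ Equiv.Perm Alp)} (h : PortraitCode ψ B g w)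
    (h' : PortraitCode ψ B g' w') (he : w ++ u = w' ++ u') : g = g' ∧ u = u' := by
  induction h generalizing g' w' u u' with
  | leaf b =>
    cases h' with
    | leaf b' => simpa [Subtype.ext_iff] using he
    | node g' ws' h' => simp at he
  | node g ws h ih =>
    cases h' with
    | leaf b' => simp at he
    | node g' ws' h' =>
      simp only [List.cons_append, List.cons.injEq, Sum.inr.injEq] at he
      obtain ⟨hact, he⟩ := he
      have key : ∀ l : List Alp, l.flatMap ws ++ u = l.flatMap ws' ++ u' →
          (∀ x ∈ l, ψ.sec g x = ψ.sec g' x) ∧ u = u' := by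
        intro l
        induction l with
        | nil => simp
        | cons x l ihl =>
          intro hl
          simp only [List.flatMap_cons, List.append_assoc] at hl
          obtain ⟨hx, hl⟩ := ih x (h' x) hl
          simpa [hx] using ihl hl
      obtain ⟨hsec, hu⟩ := key _ he
      refine ⟨ψ.inj (Prod.ext (funext fun x => hsec x (by simp)) hact), hu⟩

lemma length_flatMap_toList {β : Type*} (ws : Alp → List β) :
    (Finset.univ.toList.flatMap ws).length = ∑ x, (ws x).length := by
  rw [List.length_flatMap, Finset.sum_map_toList]

end Contraction

/-- There are at most `(card A + 1) ^ n` words of length at most `n` over `A`. -/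
lemma card_le_of_injective_list {X A : Type*} [Finite A] {n : ℕ} (f : X → List A)
    (hf : Function.Injective f) (hn : ∀ x, (f x).length ≤ n) :
    Nat.card X ≤ (Nat.card A + 1) ^ n := by
  have hinj : Function.Injective fun x : X => fun i : Fin n => (f x)[(i : ℕ)]? := by
    intro x y hxy
    apply hf
    apply List.ext_getElem?
    intro i
    by_cases hi : i < n
    · exact congrFun hxy ⟨i, hi⟩
    · rw [List.getElem?_eq_none ((hn x).trans (not_lt.1 hi)),
        List.getElem?_eq_none ((hn y).trans (not_lt.1 hi))]
  simpa [Nat.card_fun, Finite.card_option] using Nat.card_le_card_of_injective _ hinj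

section Exponent

lemma contraction_exponent_mem_Ioo {d η : ℝ} (hd : 1 < d) (hη : η ∈ Set.Ioo (0 : ℝ) 1) :
    Real.log d / (Real.log d - Real.log η) ∈ Set.Ioo (0 : ℝ) 1 := by
  have h1 := Real.log_pos hd
  have h2 := Real.log_neg hη.1 hη.2
  have h3 : 0 < Real.log d - Real.log η := by linarith
  refine ⟨div_pos h1 h3, ?_⟩
  rw [div_lt_one h3]
  linarith

lemma mul_div_rpow_contraction_exponent {d η y : ℝ} (hd : 1 < d) (hη : η ∈ Set.Ioo (0 : ℝ) 1)
    (hy : 0 ≤ y) :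
    d * (y / d) ^ (Real.log d / (Real.log d - Real.log η)) =
      (y / η) ^ (Real.log d / (Real.log d - Real.log η)) := by
  have h1 := Real.log_pos hd
  have h2 := Real.log_neg hη.1 hη.2
  have h3 : Real.log d - Real.log η ≠ 0 := by linarith
  have hd0 : 0 < d := by linarith
  set α := Real.log d / (Real.log d - Real.log η) with hα
  have key : (d / η) ^ α = d := by
    rw [Real.rpow_def_of_pos (div_pos hd0 hη.1), Real.log_div hd0.ne' hη.1.ne', hα,
      mul_div_cancel₀ _ h3, Real.exp_log hd0]
  have : y / η = d / η * (y / d) := by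
    field_simp
  rw [this, Real.mul_rpow (div_pos hd0 hη.1).le (div_nonneg hy hd0.le), key]

lemma sum_rpow_le_card_mul {ι : Type*} [Fintype ι] [Nonempty ι] {α : ℝ} (h0 : 0 ≤ α) (h1 : α ≤ 1)
    (f : ι → ℝ) (hf : ∀ i, 0 ≤ f i) :
    ∑ i, f i ^ α ≤ Fintype.card ι * ((∑ i, f i) / Fintype.card ι) ^ α := by
  have hc : (0 : ℝ) < Fintype.card ι := by exact_mod_cast Fintype.card_pos
  have := (Real.concaveOn_rpow h0 h1).le_map_sum (t := Finset.univ)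
    (w := fun _ : ι => (Fintype.card ι : ℝ)⁻¹) (p := f) (fun _ _ => by positivity)
    (by simp [hc.ne']) (fun i _ => hf i)
  simp only [smul_eq_mul, ← Finset.mul_sum] at this
  rw [inv_mul_le_iff₀ hc] at this
  rwa [div_eq_inv_mul]

lemma eventually_add_rpow_le {α : ℝ} (h0 : 0 ≤ α) (h1 : α < 1) {t ε : ℝ} (ht : 0 ≤ t)
    (hε : 0 < ε) : ∀ᶠ x : ℝ in Filter.atTop, (x + t) ^ α ≤ x ^ α + ε := by
  have hlim : Filter.Tendsto (fun x : ℝ => t * x ^ (-(1 - α))) Filter.atTop (nhds (t * 0)) :=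
    (tendsto_rpow_neg_atTop (by linarith)).const_mul t
  rw [mul_zero] at hlim
  filter_upwards [hlim.eventually_lt_const hε, Filter.eventually_gt_atTop 0] with x hx hx0
  have hb := rpow_one_add_le_one_add_mul_self (s := t / x) (p := α)
    (by linarith [div_nonneg ht hx0.le]) h0 h1.le
  have hxt : x + t = x * (1 + t / x) := by field_simp
  have hpow : x ^ (-(1 - α)) = x ^ α / x := by
    rw [neg_sub, Real.rpow_sub_one hx0.ne']
  rw [hpow] at hx
  rw [hxt, Real.mul_rpow hx0.le (by positivity)]
  have hxα : 0 < x ^ α := Real.rpow_pos_of_pos hx0 α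
  calc x ^ α * (1 + t / x) ^ α ≤ x ^ α * (1 + α * (t / x)) := by gcongr
    _ ≤ x ^ α * (1 + 1 * (t / x)) := by gcongr
    _ = x ^ α + t * (x ^ α / x) := by ring
    _ ≤ x ^ α + ε := by linarith

end Exponent

/-- If sections contract strongly up to an additive constant, then every element has a portrait
code of length sublinear in its norm, with exponent dictated by the contraction ratio. -/
lemma exists_portraitCode_length_le {G : Type*} [Group G] {S : Set G} {π : G → ℝ}
    {Alp : Type*} [Fintype Alp] (hd : 2 ≤ Fintype.card Alp) (ψ : WreathEmbedding G Alp)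
    (hπ : ∀ s ∈ S, 0 < π s) {η : ℝ} (hη : η ∈ Set.Ioo (0 : ℝ) 1) {C : ℝ} (hC : 0 ≤ C)
    (hsec : ∀ g : G, ∑ x, wnorm S π (ψ.sec g x) ≤ η * wnorm S π g + C) :
    ∃ K : ℝ, ∀ g : G, ∃ w, PortraitCode ψ {g | wnorm S π g ≤ K} g w ∧
      (w.length : ℝ) ≤ 3 * (wnorm S π g + 1) ^ (Real.log (Fintype.card Alp) /
          (Real.log (Fintype.card Alp) - Real.log η)) - 2 := by
  have hd' : (2 : ℝ) ≤ Fintype.card Alp := by exact_mod_cast hd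
  have : Nonempty Alp := Fintype.card_pos_iff.1 (by omega)
  have hα := contraction_exponent_mem_Ioo (d := Fintype.card Alp) (by linarith) hη
  have hmul := fun y => mul_div_rpow_contraction_exponent (d := Fintype.card Alp) (y := y)
    (by linarith) hη
  set α := Real.log (Fintype.card Alp) / (Real.log (Fintype.card Alp) - Real.log η)
  set d : ℝ := (Fintype.card Alp : ℝ) with hd_def
  have hη0 := hη.1
  have hη1 : 0 < 1 - η := by linarith [hη.2]
  have ht : 0 ≤ (C + d) / η - 1 := by
    rw [sub_nonneg, one_le_div hη0]
    linarith [hη.2]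
  obtain ⟨K₀, hK₀⟩ := Filter.eventually_atTop.1
    (eventually_add_rpow_le hα.1.le hα.2 ht (by norm_num : (0 : ℝ) < 1 / 3))
  set K := max K₀ ((C + 1) / (1 - η))
  refine ⟨K, ?_⟩
  have hind : ∀ n : ℕ, ∀ g : G, wnorm S π g ≤ n → ∃ w, PortraitCode ψ {g | wnorm S π g ≤ K} g w ∧
      (w.length : ℝ) ≤ 3 * (wnorm S π g + 1) ^ α - 2 := by
    intro n
    induction n with
    | zero =>
      intro g hg
      have h0 : (0 : ℝ) ≤ K := le_max_of_le_right (by positivity)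
      refine ⟨_, .leaf ⟨g, show wnorm S π g ≤ K from le_trans (by simpa using hg) h0⟩, ?_⟩
      have := Real.one_le_rpow (x := wnorm S π g + 1) (by linarith [wnorm_nonneg hπ g]) hα.1.le
      simp only [List.length_singleton, Nat.cast_one]
      linarith
    | succ n ih =>
      intro g hg
      by_cases hgK : wnorm S π g ≤ K
      · refine ⟨_, .leaf ⟨g, hgK⟩, ?_⟩
        have := Real.one_le_rpow (x := wnorm S π g + 1) (by linarith [wnorm_nonneg hπ g]) hα.1.le
        simp only [List.length_singleton, Nat.cast_one]
        linarith
      · push Not at hgK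
        have hKη : (C + 1) / (1 - η) < wnorm S π g := (le_max_right _ _).trans_lt hgK
        rw [div_lt_iff₀ hη1] at hKη
        push_cast at hg
        have hchild : ∀ x, wnorm S π (ψ.sec g x) ≤ n := fun x => by
          have := Finset.single_le_sum (f := fun x => wnorm S π (ψ.sec g x))
            (fun x _ => wnorm_nonneg hπ _) (Finset.mem_univ x)
          linarith [hsec g]
        choose ws hcode hlen using fun x => ih (ψ.sec g x) (hchild x)
        refine ⟨_, .node g ws hcode, ?_⟩
        rw [List.length_cons, length_flatMap_toList]
        push_cast
        have h1 := Finset.sum_le_sum fun x (_ : x ∈ Finset.univ) => hlen x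
        have h2 := sum_rpow_le_card_mul hα.1.le hα.2.le (fun x => wnorm S π (ψ.sec g x) + 1)
          fun x => by linarith [wnorm_nonneg hπ (ψ.sec g x)]
        have hsum : ∑ x, (wnorm S π (ψ.sec g x) + 1) ≤ η * wnorm S π g + C + d := by
          simpa [Finset.sum_add_distrib, hd_def] using hsec g
        have hsum0 : 0 ≤ ∑ x, (wnorm S π (ψ.sec g x) + 1) :=
          Finset.sum_nonneg fun x _ => by linarith [wnorm_nonneg hπ (ψ.sec g x)]
        rw [hmul _ hsum0] at h2
        have h3 : ((∑ x, (wnorm S π (ψ.sec g x) + 1)) / η) ^ α ≤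
            (wnorm S π g + 1 + ((C + d) / η - 1)) ^ α := by
          refine Real.rpow_le_rpow (by positivity) ?_ hα.1.le
          rw [div_le_iff₀ hη0]
          have : (wnorm S π g + 1 + ((C + d) / η - 1)) * η = η * wnorm S π g + C + d := by
            field_simp
            ring
          linarith
        have h4 := hK₀ (wnorm S π g + 1) (by linarith [le_max_left K₀ ((C + 1) / (1 - η))])
        simp only [Finset.sum_sub_distrib, ← Finset.mul_sum, Finset.sum_const, Finset.card_univ,
          nsmul_eq_mul, ← hd_def] at h1
        linarith
  intro g
  exact hind _ g (Nat.le_ceil _)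

/-- strong contraction method: if `G` is self-similar over an alphabet with
`d ≥ 2` letters and admits an egg `Δ` all of whose words are strongly contracting with ratio
`η < 1`, then `γ_{G,S,π}(ℓ) ≤ exp(c·ℓ^α)` with `α = log d / (log d − log η)`; in particular
`G` has subexponential growth. -/
theorem subexponential_growth_of_contracting_egg {G : Type*} [Group G]
    (Alp : Type*) [Fintype Alp] (hd : 2 ≤ Fintype.card Alp)
    (ψ : WreathEmbedding G Alp)
    (S : Set G) (π : G → ℝ)
    (hSfin : S.Finite) (hone : (1 : G) ∉ S)
    (hgen : ∀ g : G, ∃ w : List G, (∀ x ∈ w, x ∈ S) ∧ w.prod = g)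
    (hπ : ∀ s ∈ S, 0 < π s)
    (Δ : Set (List G)) (hΔ : IsEgg S π Δ)
    (η : ℝ) (hη : η ∈ Set.Ioo (0 : ℝ) 1)
    (hcontr : ∀ δ ∈ Δ, ∑ x : Alp, wnorm S π (ψ.sec δ.prod x) ≤ η * wnorm S π δ.prod) :
    ∃ c : ℝ, 0 < c ∧ ∀ ℓ : ℝ, 0 ≤ ℓ →
      (growth S π ℓ : ℝ) ≤
        Real.exp (c * ℓ ^ (Real.log (Fintype.card Alp) /
          (Real.log (Fintype.card Alp) - Real.log η))) := by
  have hd1 : (1 : ℝ) < Fintype.card Alp := by exact_mod_cast hd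
  have hα := contraction_exponent_mem_Ioo hd1 hη
  obtain ⟨C, hC, hsec⟩ := exists_sum_wnorm_sec_le ψ hπ hgen hΔ hη.1.le hcontr
  obtain ⟨K, hK⟩ := exists_portraitCode_length_le hd ψ hπ hη hC hsec
  set α := Real.log (Fintype.card Alp) / (Real.log (Fintype.card Alp) - Real.log η)
  obtain ⟨m, hm0, hm⟩ := exists_pos_le_weight hSfin hπ
  have hball : Finite {g : G | wnorm S π g ≤ K} := finite_ball hSfin hπ hgen K
  choose code hcode hlen using hK
  set a : ℝ := Nat.card ({g : G | wnorm S π g ≤ K} ⊕ Equiv.Perm Alp) + 1 with ha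
  have ha1 : 1 < a := by
    have : 0 < Nat.card ({g : G | wnorm S π g ≤ K} ⊕ Equiv.Perm Alp) := Nat.card_pos
    rw [ha]
    exact lt_add_of_pos_left 1 (by exact_mod_cast this)
  have hloga := Real.log_pos ha1
  refine ⟨Real.log a * (3 * (1 + 1 / m) ^ α), by positivity, fun ℓ hℓ => ?_⟩
  rcases lt_or_ge ℓ m with hlm | hlm
  · have hcard : growth S π ℓ ≤ 1 := by
      have : Subsingleton {g : G | wnorm S π g ≤ ℓ} := ⟨fun g h => Subtype.ext <| by
        rw [eq_one_of_wnorm_lt hgen hm hπ (g.2.trans_lt hlm),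
          eq_one_of_wnorm_lt hgen hm hπ (h.2.trans_lt hlm)]⟩
      exact Finite.card_le_one_iff_subsingleton.2 this
    calc (growth S π ℓ : ℝ) ≤ 1 := by exact_mod_cast hcard
      _ ≤ _ := Real.one_le_exp (by positivity)
  · have hcard : growth S π ℓ ≤ _ ^ ⌊3 * (ℓ + 1) ^ α⌋₊ :=
      card_le_of_injective_list (fun g : {g : G | wnorm S π g ≤ ℓ} => code g)
        (fun g h hgh => Subtype.ext
          ((hcode g).eq_of_append_eq (hcode h) (congrArg (· ++ []) hgh)).1)
        (fun g => Nat.le_floor <| by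
          have hpow : (wnorm S π g + 1) ^ α ≤ (ℓ + 1) ^ α :=
            Real.rpow_le_rpow (by linarith [wnorm_nonneg hπ (g : G)])
              (by linarith [show wnorm S π g ≤ ℓ from g.2]) hα.1.le
          linarith [hlen g])
    have hscale : (ℓ + 1) ^ α ≤ (1 + 1 / m) ^ α * ℓ ^ α := by
      rw [← Real.mul_rpow (by positivity) hℓ]
      refine Real.rpow_le_rpow (by linarith) ?_ hα.1.le
      have : 1 ≤ 1 / m * ℓ := by rwa [one_div_mul_eq_div, one_le_div hm0]
      linarith
    calc (growth S π ℓ : ℝ) ≤ a ^ ⌊3 * (ℓ + 1) ^ α⌋₊ := by rw [ha]; exact_mod_cast hcard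
      _ = Real.exp (Real.log a * ⌊3 * (ℓ + 1) ^ α⌋₊) := by
        rw [← Real.rpow_natCast, Real.rpow_def_of_pos (by linarith)]
      _ ≤ Real.exp (Real.log a * (3 * (1 + 1 / m) ^ α) * ℓ ^ α) := by
        rw [Real.exp_le_exp, mul_assoc]
        refine mul_le_mul_of_nonneg_left ?_ hloga.le
        have := Nat.floor_le (a := 3 * (ℓ + 1) ^ α) (by positivity)
        linarith
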